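/- arXiv:2311.05767 — 7 statements merged into one kernel-verified Lean document; each statement's English description precedes it below -/
import Mathlib

section
/- Conservation of framelet Dirichlet energy (Proposition 1, single channel): for every vector x ∈ ℝⁿ, the sum of the framelet Dirichlet energies over all passes equals the Dirichlet energy of x, i.e. Σ_{k=0}^{m} (W_k x)ᵀ Δ (W_k x) = xᵀ Δ x. -/
open Matrix BigOperators

/-- Conjugating a product of orthogonally diagonalized matrices merges the diagonal factors. -/
theorem Matrix.IsDiag.transpose_conj_mul_conj {ι : Type*} [Fintype ι] [DecidableEq ι]
    {U Λ D : Matrix ι ι ℝ} (hU : U * Uᵀ = 1) (hΛ : Λ.IsDiag) (hD : D.IsDiag) :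
    (Uᵀ * D * U)ᵀ * (Uᵀ * Λ * U) * (Uᵀ * D * U) = Uᵀ * (Λ * D ^ 2) * U := by
  have hcomm : D * Λ = Λ * D := by
    rw [← hD.diagonal_diag, ← hΛ.diagonal_diag]
    exact (Matrix.commute_diagonal _ _).eq
  have hsymm : Dᵀ = D := hD.isSymm
  calc (Uᵀ * D * U)ᵀ * (Uᵀ * Λ * U) * (Uᵀ * D * U)
      = Uᵀ * D * (U * Uᵀ) * Λ * (U * Uᵀ) * D * U := by
        simp only [Matrix.transpose_mul, Matrix.transpose_transpose, hsymm, Matrix.mul_assoc]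
    _ = Uᵀ * (D * Λ * D) * U := by
        simp only [hU, Matrix.mul_one, Matrix.mul_assoc]
    _ = Uᵀ * (Λ * D ^ 2) * U := by
        rw [hcomm, pow_two, Matrix.mul_assoc Λ]

/-- Conservation of framelet Dirichlet energy (Proposition 1, single channel):
for every vector `x ∈ ℝⁿ`, the sum of the framelet Dirichlet energies over all passes
equals the Dirichlet energy of `x`. -/
theorem framelet_dirichlet_energy_conservation
    (n m : ℕ) (hn : 1 ≤ n)
    (U Λ : Matrix (Fin n) (Fin n) ℝ)
    (hU : Uᵀ * U = 1)
    (hΛdiag : Λ.IsDiag) (hΛpos : ∀ i, 0 ≤ Λ i i)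
    (Δ : Matrix (Fin n) (Fin n) ℝ) (hΔ : Δ = Uᵀ * Λ * U)
    (Λs : Fin (m + 1) → Matrix (Fin n) (Fin n) ℝ)
    (hΛs : ∀ k, (Λs k).IsDiag)
    (htight : ∑ k, (Λs k) ^ 2 = 1)
    (W : Fin (m + 1) → Matrix (Fin n) (Fin n) ℝ)
    (hW : ∀ k, W k = Uᵀ * Λs k * U)
    (x : Fin n → ℝ) :
    ∑ k, ((W k).mulVec x) ⬝ᵥ (Δ.mulVec ((W k).mulVec x)) = x ⬝ᵥ Δ.mulVec x := by
  have hU' : U * Uᵀ = 1 := mul_eq_one_comm.mp hU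
  have hterm (k : Fin (m + 1)) : ((W k).mulVec x) ⬝ᵥ (Δ.mulVec ((W k).mulVec x)) =
      x ⬝ᵥ (Uᵀ * (Λ * Λs k ^ 2) * U).mulVec x := by
    rw [← hΛdiag.transpose_conj_mul_conj hU' (hΛs k), ← hW k, ← hΔ, Matrix.mul_assoc,
      ← Matrix.mulVec_mulVec, Matrix.dotProduct_mulVec x, Matrix.vecMul_transpose,
      Matrix.mulVec_mulVec]
  simp only [hterm]
  rw [← dotProduct_sum, ← Matrix.sum_mulVec, ← Finset.sum_mul, ← Finset.mul_sum,
    ← Finset.mul_sum, htight, Matrix.mul_one, hΔ]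
end

section
/- Conservation of framelet Dirichlet energy (Proposition 1, multi-channel): for every feature matrix X ∈ ℝ^{n×d}, Σ_{k=0}^{m} trace((W_k X)ᵀ Δ (W_k X)) = trace(Xᵀ Δ X). -/
open Matrix BigOperators

/-- Diagonal matrices over a commutative semiring commute. -/
theorem Matrix.IsDiag.commute {ι R : Type*} [Fintype ι] [DecidableEq ι] [CommSemiring R]
    {A B : Matrix ι ι R} (hA : A.IsDiag) (hB : B.IsDiag) : Commute A B := by
  rw [← hA.diagonal_diag, ← hB.diagonal_diag]
  exact commute_diagonal _ _

/-- Conjugating by an orthogonal matrix turns the quadratic form of a filtered signal into the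
quadratic form with the filter squared. -/
theorem transpose_mul_conj_mul_eq {ι κ R : Type*} [Fintype ι] [DecidableEq ι] [CommRing R]
    {U L D : Matrix ι ι R} (hU : Uᵀ * U = 1) (hL : L.IsDiag) (hD : D.IsDiag)
    (X : Matrix ι κ R) :
    (Uᵀ * D * U * X)ᵀ * (Uᵀ * L * U) * (Uᵀ * D * U * X) = Xᵀ * (Uᵀ * (L * D ^ 2) * U) * X := by
  have hU' : U * Uᵀ = 1 := mul_eq_one_comm.mp hU
  have cancel (M : Matrix ι κ R) : U * (Uᵀ * M) = M := by
    rw [← Matrix.mul_assoc, hU', Matrix.one_mul]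
  have swap (M : Matrix ι κ R) : D * (L * M) = L * (D * M) := by
    rw [← Matrix.mul_assoc, (hD.commute hL).eq, Matrix.mul_assoc]
  simp only [transpose_mul, transpose_transpose, hD.isSymm.eq, pow_two, Matrix.mul_assoc,
    cancel, swap]

/-- Conservation of framelet Dirichlet energy (Proposition 1, multi-channel):
for every feature matrix `X ∈ ℝ^{n×d}`,
`Σ_{k=0}^{m} trace((W_k X)ᵀ Δ (W_k X)) = trace(Xᵀ Δ X)`. -/
theorem framelet_dirichlet_energy_conservation_multichannel
    (n m d : ℕ) (hn : 1 ≤ n)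
    (U Λ : Matrix (Fin n) (Fin n) ℝ)
    (hU : Uᵀ * U = 1)
    (hΛdiag : Λ.IsDiag) (hΛpos : ∀ i, 0 ≤ Λ i i)
    (Δ : Matrix (Fin n) (Fin n) ℝ) (hΔ : Δ = Uᵀ * Λ * U)
    (Λs : Fin (m + 1) → Matrix (Fin n) (Fin n) ℝ)
    (hΛs : ∀ k, (Λs k).IsDiag)
    (htight : ∑ k, (Λs k) ^ 2 = 1)
    (W : Fin (m + 1) → Matrix (Fin n) (Fin n) ℝ)
    (hW : ∀ k, W k = Uᵀ * Λs k * U)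
    (X : Matrix (Fin n) (Fin d) ℝ) :
    ∑ k, ((W k * X)ᵀ * Δ * (W k * X)).trace = (Xᵀ * Δ * X).trace := by
  simp_rw [hW, hΔ, transpose_mul_conj_mul_eq hU hΛdiag (hΛs _)]
  rw [← trace_sum, ← Matrix.sum_mul, ← Matrix.mul_sum, ← Matrix.sum_mul, ← Matrix.mul_sum,
    ← Matrix.mul_sum, htight, Matrix.mul_one]
end

section
/- Energy-difference identity for Framelet Augmentation (key identity in the proof of Theorem 2): for every diagonal matrix D with positive diagonal entries, every ε ∈ ℝ, and every x ∈ ℝⁿ, E_total^ε(x) − xᵀ Δ x = ε · [ (W_0 x)ᵀ D⁻¹ (W_0 x) − Σ_{k=1}^{m} (W_k x)ᵀ D⁻¹ (W_k x) ]. -/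
open Matrix BigOperators

/-- Conjugating by an orthogonal matrix turns a commuting pair `A`, `L` into `Uᵀ L A² U`. -/
theorem Matrix.conj_transpose_mul_conj_mul_conj {n R : Type*} [Fintype n] [DecidableEq n]
    [CommRing R] {U A L : Matrix n n R} (hU : Uᵀ * U = 1) (hA : A.IsSymm) (hAL : Commute A L) :
    (Uᵀ * A * U)ᵀ * (Uᵀ * L * U) * (Uᵀ * A * U) = Uᵀ * (L * A ^ 2) * U := by
  have hU' : U * Uᵀ = 1 := mul_eq_one_comm.mp hU
  have cancel (M : Matrix n n R) : U * (Uᵀ * M) = M := by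
    rw [← Matrix.mul_assoc, hU', Matrix.one_mul]
  have swap (M : Matrix n n R) : A * (L * M) = L * (A * M) := by
    rw [← Matrix.mul_assoc, hAL.eq, Matrix.mul_assoc]
  simp only [transpose_mul, transpose_transpose, hA.eq, Matrix.mul_assoc, cancel, swap, pow_two]

/-- A tight frame of spectral filters commuting with `L` preserves the quadratic form of
`Uᵀ L U`. -/
theorem Matrix.sum_dotProduct_conj_mulVec {n ι R : Type*} [Fintype n] [DecidableEq n] [Fintype ι]
    [CommRing R] {U L : Matrix n n R} {A : ι → Matrix n n R} (hU : Uᵀ * U = 1)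
    (hA : ∀ k, (A k).IsSymm) (hAL : ∀ k, Commute (A k) L) (htight : ∑ k, A k ^ 2 = 1)
    (x : n → R) :
    ∑ k, ((Uᵀ * A k * U) *ᵥ x) ⬝ᵥ ((Uᵀ * L * U) *ᵥ ((Uᵀ * A k * U) *ᵥ x)) =
      x ⬝ᵥ ((Uᵀ * L * U) *ᵥ x) := by
  have hterm (k : ι) : ((Uᵀ * A k * U) *ᵥ x) ⬝ᵥ ((Uᵀ * L * U) *ᵥ ((Uᵀ * A k * U) *ᵥ x)) =
      x ⬝ᵥ ((Uᵀ * (L * A k ^ 2) * U) *ᵥ x) := by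
    rw [← conj_transpose_mul_conj_mul_conj hU (hA k) (hAL k)]
    generalize Uᵀ * A k * U = W, Uᵀ * L * U = M
    rw [← mulVec_mulVec, ← mulVec_mulVec, dotProduct_mulVec x, vecMul_transpose]
  simp_rw [hterm]
  rw [← dotProduct_sum, ← Matrix.sum_mulVec, ← Finset.sum_mul, ← Finset.mul_sum,
    ← Finset.mul_sum, htight, Matrix.mul_one]

/-- Energy-difference identity for Framelet Augmentation (key identity in the proof of
Theorem 2): for every diagonal matrix `D` with positive diagonal entries, every `ε ∈ ℝ`,
and every `x ∈ ℝⁿ`,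
`E_total^ε(x) − xᵀ Δ x = ε · [(W_0 x)ᵀ D⁻¹ (W_0 x) − Σ_{k=1}^{m} (W_k x)ᵀ D⁻¹ (W_k x)]`. -/
theorem framelet_augmentation_energy_difference
    (n m : ℕ) (hn : 1 ≤ n)
    (U Λ : Matrix (Fin n) (Fin n) ℝ)
    (hU : Uᵀ * U = 1)
    (hΛdiag : Λ.IsDiag) (hΛpos : ∀ i, 0 ≤ Λ i i)
    (Δ : Matrix (Fin n) (Fin n) ℝ) (hΔ : Δ = Uᵀ * Λ * U)
    (Λs : Fin (m + 1) → Matrix (Fin n) (Fin n) ℝ)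
    (hΛs : ∀ k, (Λs k).IsDiag)
    (htight : ∑ k, (Λs k) ^ 2 = 1)
    (W : Fin (m + 1) → Matrix (Fin n) (Fin n) ℝ)
    (hW : ∀ k, W k = Uᵀ * Λs k * U)
    (D : Matrix (Fin n) (Fin n) ℝ)
    (hDdiag : D.IsDiag) (hDpos : ∀ i, 0 < D i i)
    (ε : ℝ) (x : Fin n → ℝ) :
    (((W 0).mulVec x) ⬝ᵥ (Δ + ε • D⁻¹).mulVec ((W 0).mulVec x) +
        ∑ k : Fin m, ((W k.succ).mulVec x) ⬝ᵥ (Δ - ε • D⁻¹).mulVec ((W k.succ).mulVec x)) -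
      x ⬝ᵥ Δ.mulVec x =
    ε * (((W 0).mulVec x) ⬝ᵥ D⁻¹.mulVec ((W 0).mulVec x) -
        ∑ k : Fin m, ((W k.succ).mulVec x) ⬝ᵥ D⁻¹.mulVec ((W k.succ).mulVec x)) := by
  have hcomm (k) : Commute (Λs k) Λ := by
    rw [← (hΛs k).diagonal_diag, ← hΛdiag.diagonal_diag]
    exact commute_diagonal _ _
  have key := sum_dotProduct_conj_mulVec hU (fun k => (hΛs k).isSymm) hcomm htight x
  simp only [← hW, ← hΔ, Fin.sum_univ_succ] at key
  simp only [add_mulVec, sub_mulVec, smul_mulVec, dotProduct_add, dotProduct_sub,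
    dotProduct_smul, smul_eq_mul, Finset.sum_sub_distrib, ← Finset.mul_sum]
  linear_combination key
end

section
/- Dirichlet energy enhancement (Theorem 2): assume additionally that D commutes with each framelet transform W_k and that every diagonal entry of Λ_0² − Σ_{k=1}^{m} Λ_k² is nonnegative (the energy-gap condition). Then for every ε > 0 and every x ∈ ℝⁿ, the total modified framelet Dirichlet energy satisfies E_total^ε(x) ≥ xᵀ Δ x; moreover the inequality is strict whenever every diagonal entry of Λ_0² − Σ_{k=1}^{m} Λ_k² is strictly positive and x ≠ 0. -/
open Matrix BigOperators

section

variable {ι : Type*} [Fintype ι] [DecidableEq ι]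

theorem dotProduct_conj_diagonal_mulVec (U : Matrix ι ι ℝ) (l v : ι → ℝ) :
    v ⬝ᵥ (Uᵀ * diagonal l * U) *ᵥ v = ∑ i, l i * (U *ᵥ v) i ^ 2 := by
  rw [Matrix.mul_assoc, ← mulVec_mulVec, dotProduct_mulVec, vecMul_transpose, ← mulVec_mulVec]
  simp only [dotProduct, mulVec_diagonal]
  exact Finset.sum_congr rfl fun i _ => by ring

theorem mulVec_conj_diagonal_mulVec {U : Matrix ι ι ℝ} (hU : Uᵀ * U = 1) (a x : ι → ℝ) (i : ι) :
    (U *ᵥ (Uᵀ * diagonal a * U) *ᵥ x) i = a i * (U *ᵥ x) i := by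
  have h : U * (Uᵀ * diagonal a * U) = diagonal a * U := by
    rw [Matrix.mul_assoc, ← Matrix.mul_assoc U, mul_eq_one_comm.mp hU, Matrix.one_mul]
  rw [mulVec_mulVec, h, ← mulVec_mulVec, mulVec_diagonal]

/-- A matrix commuting with a diagonal matrix commutes with every function of it. -/
theorem diagonal_comp_mul_comm {d : ι → ℝ} {W : Matrix ι ι ℝ}
    (h : diagonal d * W = W * diagonal d) (f : ℝ → ℝ) :
    diagonal (f ∘ d) * W = W * diagonal (f ∘ d) := by
  ext i j
  have hij := congrFun (congrFun h i) j
  rw [diagonal_mul, mul_diagonal] at hij ⊢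
  by_cases hw : W i j = 0
  · simp [hw]
  · have hd : d i = d j := mul_right_cancel₀ hw (by rw [hij, mul_comm])
    simp [hd, mul_comm]

theorem dotProduct_inv_diagonal_mulVec {d : ι → ℝ} (hd : ∀ i, 0 < d i) (v : ι → ℝ) :
    v ⬝ᵥ (diagonal d)⁻¹ *ᵥ v =
      (diagonal ((fun t => (√t)⁻¹) ∘ d) *ᵥ v) ⬝ᵥ (diagonal ((fun t => (√t)⁻¹) ∘ d) *ᵥ v) := by
  have hinv : (diagonal d)⁻¹ = diagonal fun i => (d i)⁻¹ := by
    refine inv_eq_right_inv ?_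
    rw [diagonal_mul_diagonal, ← diagonal_one]
    congr 1
    ext i
    exact mul_inv_cancel₀ (hd i).ne'
  rw [hinv]
  simp only [dotProduct, mulVec_diagonal, Function.comp_apply]
  refine Finset.sum_congr rfl fun i _ => ?_
  have h : (d i)⁻¹ = (√(d i))⁻¹ * (√(d i))⁻¹ := by
    rw [← mul_inv, Real.mul_self_sqrt (hd i).le]
  rw [h]
  ring

/-- In the spectral domain the framelet component `W x` has degree energy weighted by the squared
filter. -/
theorem dotProduct_inv_diagonal_conj_mulVec {U : Matrix ι ι ℝ} (hU : Uᵀ * U = 1) {d : ι → ℝ}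
    (hd : ∀ i, 0 < d i) (a x : ι → ℝ)
    (hcomm : diagonal d * (Uᵀ * diagonal a * U) = (Uᵀ * diagonal a * U) * diagonal d) :
    ((Uᵀ * diagonal a * U) *ᵥ x) ⬝ᵥ (diagonal d)⁻¹ *ᵥ ((Uᵀ * diagonal a * U) *ᵥ x) =
      ∑ i, a i ^ 2 * (U *ᵥ diagonal ((fun t => (√t)⁻¹) ∘ d) *ᵥ x) i ^ 2 := by
  have hnorm (v : ι → ℝ) : v ⬝ᵥ v = ∑ i, (U *ᵥ v) i ^ 2 := by
    simpa [hU] using dotProduct_conj_diagonal_mulVec U 1 v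
  rw [dotProduct_inv_diagonal_mulVec hd, mulVec_mulVec, diagonal_comp_mul_comm hcomm,
    ← mulVec_mulVec, hnorm]
  simp only [mulVec_conj_diagonal_mulVec hU, mul_pow]

end

/-- Dirichlet energy enhancement (Theorem 2): assume `D` commutes with each framelet
transform `W_k` and every diagonal entry of `Λ_0² − Σ_{k=1}^{m} Λ_k²` is nonnegative
(the energy-gap condition). Then for every `ε > 0` and every `x ∈ ℝⁿ`,
`E_total^ε(x) ≥ xᵀ Δ x`; moreover the inequality is strict whenever every diagonal entry
of `Λ_0² − Σ_{k=1}^{m} Λ_k²` is strictly positive and `x ≠ 0`. -/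
theorem framelet_augmentation_energy_enhancement
    (n m : ℕ) (hn : 1 ≤ n)
    (U Λ : Matrix (Fin n) (Fin n) ℝ)
    (hU : Uᵀ * U = 1)
    (hΛdiag : Λ.IsDiag) (hΛpos : ∀ i, 0 ≤ Λ i i)
    (Δ : Matrix (Fin n) (Fin n) ℝ) (hΔ : Δ = Uᵀ * Λ * U)
    (Λs : Fin (m + 1) → Matrix (Fin n) (Fin n) ℝ)
    (hΛs : ∀ k, (Λs k).IsDiag)
    (htight : ∑ k, (Λs k) ^ 2 = 1)
    (W : Fin (m + 1) → Matrix (Fin n) (Fin n) ℝ)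
    (hW : ∀ k, W k = Uᵀ * Λs k * U)
    (D : Matrix (Fin n) (Fin n) ℝ)
    (hDdiag : D.IsDiag) (hDpos : ∀ i, 0 < D i i)
    (hcomm : ∀ k, D * W k = W k * D)
    (hgap : ∀ i, 0 ≤ (Λs 0 i i) ^ 2 - ∑ k : Fin m, (Λs k.succ i i) ^ 2)
    (ε : ℝ) (hε : 0 < ε) (x : Fin n → ℝ) :
    x ⬝ᵥ Δ.mulVec x ≤
      ((W 0).mulVec x) ⬝ᵥ (Δ + ε • D⁻¹).mulVec ((W 0).mulVec x) +
        ∑ k : Fin m, ((W k.succ).mulVec x) ⬝ᵥ (Δ - ε • D⁻¹).mulVec ((W k.succ).mulVec x) ∧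
    ((∀ i, 0 < (Λs 0 i i) ^ 2 - ∑ k : Fin m, (Λs k.succ i i) ^ 2) → x ≠ 0 →
      x ⬝ᵥ Δ.mulVec x <
        ((W 0).mulVec x) ⬝ᵥ (Δ + ε • D⁻¹).mulVec ((W 0).mulVec x) +
          ∑ k : Fin m, ((W k.succ).mulVec x) ⬝ᵥ (Δ - ε • D⁻¹).mulVec ((W k.succ).mulVec x)) := by
  obtain ⟨l, rfl⟩ : ∃ l, Λ = diagonal l := ⟨_, hΛdiag.diagonal_diag.symm⟩
  obtain ⟨d, rfl⟩ : ∃ d, D = diagonal d := ⟨_, hDdiag.diagonal_diag.symm⟩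
  obtain ⟨a, rfl⟩ : ∃ a : Fin (m + 1) → Fin n → ℝ, Λs = fun k => diagonal (a k) :=
    ⟨fun k => (Λs k).diag, funext fun k => (hΛs k).diagonal_diag.symm⟩
  obtain rfl : W = fun k => Uᵀ * diagonal (a k) * U := funext hW
  subst hΔ
  simp only [diagonal_apply_eq] at hDpos hgap ⊢
  have hsum (i : Fin n) : a 0 i ^ 2 + ∑ k : Fin m, a k.succ i ^ 2 = 1 := by
    have h := congrFun (congrFun htight i) i
    simpa [Matrix.sum_apply, diagonal_pow, Fin.sum_univ_succ] using h
  let y : Fin n → ℝ := U *ᵥ diagonal ((fun t => (√t)⁻¹) ∘ d) *ᵥ x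
  have hdirichlet (k : Fin (m + 1)) :
      ((Uᵀ * diagonal (a k) * U) *ᵥ x) ⬝ᵥ
        (Uᵀ * diagonal l * U) *ᵥ ((Uᵀ * diagonal (a k) * U) *ᵥ x) =
      ∑ i, a k i ^ 2 * (l i * (U *ᵥ x) i ^ 2) := by
    rw [dotProduct_conj_diagonal_mulVec]
    refine Finset.sum_congr rfl fun i _ => ?_
    rw [mulVec_conj_diagonal_mulVec hU]
    ring
  have hdegree (k : Fin (m + 1)) :
      ((Uᵀ * diagonal (a k) * U) *ᵥ x) ⬝ᵥ
        (diagonal d)⁻¹ *ᵥ ((Uᵀ * diagonal (a k) * U) *ᵥ x) = ∑ i, a k i ^ 2 * y i ^ 2 :=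
    dotProduct_inv_diagonal_conj_mulVec hU hDpos (a k) x (hcomm k)
  have hswap (z : Fin n → ℝ) : ∑ k : Fin m, ∑ i, a k.succ i ^ 2 * z i =
      ∑ i, (∑ k : Fin m, a k.succ i ^ 2) * z i := by
    rw [Finset.sum_comm]
    simp only [Finset.sum_mul]
  have htotal :
      ((Uᵀ * diagonal (a 0) * U) *ᵥ x) ⬝ᵥ
          (Uᵀ * diagonal l * U + ε • (diagonal d)⁻¹) *ᵥ ((Uᵀ * diagonal (a 0) * U) *ᵥ x) +
        ∑ k : Fin m, ((Uᵀ * diagonal (a k.succ) * U) *ᵥ x) ⬝ᵥ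
          (Uᵀ * diagonal l * U - ε • (diagonal d)⁻¹) *ᵥ
            ((Uᵀ * diagonal (a k.succ) * U) *ᵥ x) =
      x ⬝ᵥ (Uᵀ * diagonal l * U) *ᵥ x +
        ε * ∑ i, (a 0 i ^ 2 - ∑ k : Fin m, a k.succ i ^ 2) * y i ^ 2 := by
    simp only [add_mulVec, sub_mulVec, smul_mulVec, dotProduct_add, dotProduct_sub,
      dotProduct_smul, smul_eq_mul, hdirichlet, hdegree, Finset.sum_sub_distrib,
      ← Finset.mul_sum, hswap, sub_mul]
    have hΔ : x ⬝ᵥ (Uᵀ * diagonal l * U) *ᵥ x =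
        ∑ i, a 0 i ^ 2 * (l i * (U *ᵥ x) i ^ 2) +
          ∑ i, (∑ k : Fin m, a k.succ i ^ 2) * (l i * (U *ᵥ x) i ^ 2) := by
      simp only [← Finset.sum_add_distrib, ← add_mul, hsum, one_mul,
        dotProduct_conj_diagonal_mulVec]
    rw [hΔ]
    ring
  rw [htotal]
  refine ⟨le_add_of_nonneg_right (mul_nonneg hε.le (Finset.sum_nonneg fun i _ =>
    mul_nonneg (hgap i) (sq_nonneg _))), fun hpos hx => lt_add_of_pos_right _ (mul_pos hε ?_)⟩
  have hy : y ≠ 0 := by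
    intro hy
    have hSx : diagonal ((fun t => (√t)⁻¹) ∘ d) *ᵥ x = 0 := by
      simpa [y, mulVec_mulVec, ← Matrix.mul_assoc, hU] using congrArg (Uᵀ *ᵥ ·) hy
    refine hx (funext fun i => ?_)
    have h := congrFun hSx i
    rw [mulVec_diagonal] at h
    exact (mul_eq_zero.mp h).resolve_left (inv_ne_zero (Real.sqrt_pos.mpr (hDpos i)).ne')
  obtain ⟨i, hi⟩ := Function.ne_iff.mp hy
  exact Finset.sum_pos' (fun i _ => mul_nonneg (hgap i) (sq_nonneg _))
    ⟨i, Finset.mem_univ i, mul_pos (hpos i) (sq_pos_of_ne_zero hi)⟩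
end

section
/- Dirichlet energy enhancement for the Haar-type framelet system on a regular graph (instance of Theorem 2): let Λ be diagonal with all diagonal entries in [0,2], let Λ_0, Λ_1, Λ_2 be the diagonal matrices obtained by applying a₀, a₁, a₂ respectively to the diagonal entries of Λ, and let D = c·I with c > 0. Then for every ε > 0 and every x ∈ ℝⁿ, E_total^ε(x) ≥ xᵀ Δ x. -/
open Matrix BigOperators

theorem dotProduct_transpose_mul_diagonal_mul_mulVec {m n R : Type*} [Fintype m] [Fintype n]
    [DecidableEq m] [CommSemiring R] (U : Matrix m n R) (d : m → R) (w : n → R) :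
    w ⬝ᵥ (Uᵀ * diagonal d * U) *ᵥ w = ∑ i, d i * (U *ᵥ w) i ^ 2 := by
  rw [← mulVec_mulVec, ← mulVec_mulVec, dotProduct_mulVec, vecMul_transpose]
  refine Finset.sum_congr rfl fun i _ => ?_
  rw [mulVec_diagonal]
  ring

theorem dotProduct_filtered_mulVec {n R : Type*} [Fintype n] [DecidableEq n] [CommRing R]
    {U : Matrix n n R} (hU : Uᵀ * U = 1) (lam a : n → R) (s : R) (x : n → R) :
    ((Uᵀ * diagonal a * U) *ᵥ x) ⬝ᵥ
        (Uᵀ * diagonal lam * U + s • (1 : Matrix n n R)) *ᵥ ((Uᵀ * diagonal a * U) *ᵥ x) =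
      ∑ i, (lam i + s) * (a i * (U *ᵥ x) i) ^ 2 := by
  have hshift : Uᵀ * diagonal lam * U + s • (1 : Matrix n n R) =
      Uᵀ * diagonal (fun i => lam i + s) * U := by
    rw [← diagonal_add, mul_add, add_mul, ← smul_one_eq_diagonal]
    simp [hU]
  have hfilter : U *ᵥ ((Uᵀ * diagonal a * U) *ᵥ x) = diagonal a *ᵥ (U *ᵥ x) := by
    rw [mulVec_mulVec, mulVec_mulVec, ← mul_assoc, ← mul_assoc, mul_eq_one_comm.mp hU, one_mul]
  rw [hshift, dotProduct_transpose_mul_diagonal_mul_mulVec, hfilter]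
  simp only [mulVec_diagonal]

theorem one_half_le_sq_cos_mul_cos {t : ℝ} (ht : t ∈ Set.Icc (0 : ℝ) 2) :
    1 / 2 ≤ (Real.cos (t / 8) * Real.cos (t / 16)) ^ 2 := by
  obtain ⟨h0, h2⟩ := ht
  have h8 : 9 / 10 ≤ Real.cos (t / 8) := by
    nlinarith [Real.one_sub_sq_div_two_le_cos (x := t / 8)]
  have h16 : 9 / 10 ≤ Real.cos (t / 16) := by
    nlinarith [Real.one_sub_sq_div_two_le_cos (x := t / 16)]
  have hmul : 81 / 100 ≤ Real.cos (t / 8) * Real.cos (t / 16) := by nlinarith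
  nlinarith

theorem haar_filter_sq_sum (t : ℝ) :
    (Real.cos (t / 8) * Real.cos (t / 16)) ^ 2 + (Real.sin (t / 8) * Real.cos (t / 16)) ^ 2 +
      Real.sin (t / 16) ^ 2 = 1 := by
  linear_combination Real.cos (t / 16) ^ 2 * Real.sin_sq_add_cos_sq (t / 8) +
    Real.sin_sq_add_cos_sq (t / 16)

/-- Dirichlet energy enhancement for the Haar-type framelet system on a regular graph
(instance of Theorem 2): with `Λ` diagonal with entries in `[0,2]`, the Haar-type filters
`a₀(x) = cos(x/8)cos(x/16)`, `a₁(x) = sin(x/8)cos(x/16)`, `a₂(x) = sin(x/16)` applied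
entrywise to the diagonal of `Λ`, and `D = c·I` with `c > 0`, we have for every `ε > 0`
and every `x ∈ ℝⁿ` that `E_total^ε(x) ≥ xᵀ Δ x`. -/
theorem haar_framelet_augmentation_energy_enhancement
    (n : ℕ) (hn : 1 ≤ n)
    (U : Matrix (Fin n) (Fin n) ℝ)
    (hU : Uᵀ * U = 1)
    (lam : Fin n → ℝ) (hlam : ∀ i, lam i ∈ Set.Icc (0 : ℝ) 2)
    (Δ : Matrix (Fin n) (Fin n) ℝ)
    (hΔ : Δ = Uᵀ * Matrix.diagonal lam * U)
    (W₀ W₁ W₂ : Matrix (Fin n) (Fin n) ℝ)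
    (hW₀ : W₀ = Uᵀ * Matrix.diagonal (fun i => Real.cos (lam i / 8) * Real.cos (lam i / 16)) * U)
    (hW₁ : W₁ = Uᵀ * Matrix.diagonal (fun i => Real.sin (lam i / 8) * Real.cos (lam i / 16)) * U)
    (hW₂ : W₂ = Uᵀ * Matrix.diagonal (fun i => Real.sin (lam i / 16)) * U)
    (c : ℝ) (hc : 0 < c)
    (D : Matrix (Fin n) (Fin n) ℝ) (hD : D = c • (1 : Matrix (Fin n) (Fin n) ℝ))
    (ε : ℝ) (hε : 0 < ε) (x : Fin n → ℝ) :
    x ⬝ᵥ Δ.mulVec x ≤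
      (W₀.mulVec x) ⬝ᵥ (Δ + ε • D⁻¹).mulVec (W₀.mulVec x) +
      (W₁.mulVec x) ⬝ᵥ (Δ - ε • D⁻¹).mulVec (W₁.mulVec x) +
      (W₂.mulVec x) ⬝ᵥ (Δ - ε • D⁻¹).mulVec (W₂.mulVec x) := by
  have hDinv : D⁻¹ = c⁻¹ • (1 : Matrix (Fin n) (Fin n) ℝ) :=
    inv_eq_right_inv (by simp [hD, hc.ne'])
  have hsub : Δ - ε • D⁻¹ = Δ + (-(ε * c⁻¹)) • (1 : Matrix (Fin n) (Fin n) ℝ) := by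
    rw [hDinv, smul_smul, neg_smul, sub_eq_add_neg]
  rw [hsub, hDinv, smul_smul, hΔ, hW₀, hW₁, hW₂, dotProduct_filtered_mulVec hU,
    dotProduct_filtered_mulVec hU, dotProduct_filtered_mulVec hU,
    dotProduct_transpose_mul_diagonal_mul_mulVec, ← Finset.sum_add_distrib,
    ← Finset.sum_add_distrib]
  refine Finset.sum_le_sum fun i _ => ?_
  have hs : 0 ≤ ε * c⁻¹ := by positivity
  have hlow := one_half_le_sq_cos_mul_cos (hlam i)
  have hsum := haar_filter_sq_sum (lam i)
  set a₀ := Real.cos (lam i / 8) * Real.cos (lam i / 16)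
  set a₁ := Real.sin (lam i / 8) * Real.cos (lam i / 16)
  set a₂ := Real.sin (lam i / 16)
  have hgain : 0 ≤ ε * c⁻¹ * (2 * a₀ ^ 2 - 1) * (U *ᵥ x) i ^ 2 :=
    mul_nonneg (mul_nonneg hs (by linarith)) (sq_nonneg _)
  linear_combination hgain + (ε * c⁻¹ - lam i) * (U *ᵥ x) i ^ 2 * hsum
end

section
/- Pointwise energy-gap inequality for the Haar-type filters (key inequality in the proof of Proposition B.1/energy gap): for every real x with 0 ≤ x ≤ 2, (cos(x/8)·cos(x/16))² − (sin(x/8)·cos(x/16))² − (sin(x/16))² ≥ 0. -/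
/-- Pointwise energy-gap inequality for the Haar-type filters: for every real `x` with
`0 ≤ x ≤ 2`, `(cos(x/8)·cos(x/16))² − (sin(x/8)·cos(x/16))² − (sin(x/16))² ≥ 0`. -/
theorem haar_filters_energy_gap (x : ℝ) (hx0 : 0 ≤ x) (hx2 : x ≤ 2) :
    0 ≤ (Real.cos (x / 8) * Real.cos (x / 16)) ^ 2 -
      (Real.sin (x / 8) * Real.cos (x / 16)) ^ 2 -
      (Real.sin (x / 16)) ^ 2 := by
  have h8 : Real.sin (x / 8) ^ 2 ≤ 1 / 16 := Real.sin_sq_le_sq.trans (by nlinarith)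
  have h16 : Real.sin (x / 16) ^ 2 ≤ 1 / 64 := Real.sin_sq_le_sq.trans (by nlinarith)
  simp only [mul_pow, Real.cos_sq']
  nlinarith [sq_nonneg (Real.sin (x / 8)), sq_nonneg (Real.sin (x / 16))]
end

section
/- Framelet energy gap (Proposition on energy gap, Appendix B): suppose all diagonal entries of Λ lie in [0,2]. Let V₀ = Uᵀ Λ_0 U X, W₁ = Uᵀ Λ_1 U X, W₂ = Uᵀ Λ_2 U X be the low-pass and high-pass framelet coefficients of a signal X ∈ ℝ^{n×d}, where Λ_0, Λ_1, Λ_2 apply a₀, a₁, a₂ entrywise to the diagonal of Λ. Then ‖W₁‖_F² + ‖W₂‖_F² ≤ ‖V₀‖_F², i.e. the total energy of the high passes is at most the energy of the low pass. -/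
open Matrix BigOperators

/-- The squared Frobenius energy of a real matrix is the trace of its Gram matrix. -/
theorem sum_sq_entries_eq_trace {m k : Type*} [Fintype m] [Fintype k] (M : Matrix m k ℝ) :
    ∑ i, ∑ j, (M i j) ^ 2 = (Mᵀ * M).trace := by
  rw [Finset.sum_comm]
  simp [Matrix.trace, Matrix.mul_apply, pow_two]

/-- Energy of a spectrally filtered signal, computed in the spectral domain. -/
theorem sum_sq_spectral_filter {m k : Type*} [Fintype m] [DecidableEq m] [Fintype k]
    {U : Matrix m m ℝ} (hU : Uᵀ * U = 1) (f : m → ℝ) (X : Matrix m k ℝ) :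
    ∑ i, ∑ j, ((Uᵀ * Matrix.diagonal f * U * X) i j) ^ 2
      = ∑ i, ∑ j, f i ^ 2 * ((U * X) i j) ^ 2 := by
  have hU' : U * Uᵀ = 1 := mul_eq_one_comm.mp hU
  have hisom : (Uᵀ * Matrix.diagonal f * U * X)ᵀ * (Uᵀ * Matrix.diagonal f * U * X)
      = (Matrix.diagonal f * (U * X))ᵀ * (Matrix.diagonal f * (U * X)) := by
    calc _ = (Matrix.diagonal f * (U * X))ᵀ * (U * Uᵀ) * (Matrix.diagonal f * (U * X)) := by
          simp only [Matrix.transpose_mul, Matrix.transpose_transpose, Matrix.mul_assoc]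
      _ = _ := by rw [hU', Matrix.mul_one]
  rw [sum_sq_entries_eq_trace, hisom, ← sum_sq_entries_eq_trace]
  simp only [Matrix.diagonal_mul, mul_pow]

/-- Pointwise comparison of the Haar-type framelet multipliers on `[0,2]`. -/
theorem haar_high_pass_sq_le_low_pass_sq {x : ℝ} (hx : x ∈ Set.Icc (0 : ℝ) 2) :
    (Real.sin (x / 8) * Real.cos (x / 16)) ^ 2 + Real.sin (x / 16) ^ 2
      ≤ (Real.cos (x / 8) * Real.cos (x / 16)) ^ 2 := by
  obtain ⟨h0, h2⟩ := hx
  have ha : Real.sin (x / 8) ^ 2 ≤ 1 / 16 :=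
    Real.sin_sq_le_sq.trans (by nlinarith)
  have hb : Real.sin (x / 16) ^ 2 ≤ 1 / 64 :=
    Real.sin_sq_le_sq.trans (by nlinarith)
  rw [mul_pow, mul_pow, Real.cos_sq' (x / 8), Real.cos_sq' (x / 16)]
  nlinarith [mul_nonneg (sub_nonneg.mpr ha) (sub_nonneg.mpr hb)]

/-- Framelet energy gap (Appendix B): with all eigenvalues of the normalized Laplacian in
`[0,2]`, the total (squared Frobenius) energy of the high-pass framelet coefficients is at
most that of the low-pass coefficients: `‖W₁‖_F² + ‖W₂‖_F² ≤ ‖V₀‖_F²`. -/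
theorem framelet_energy_gap
    (n d : ℕ) (hn : 1 ≤ n)
    (U : Matrix (Fin n) (Fin n) ℝ)
    (hU : Uᵀ * U = 1)
    (lam : Fin n → ℝ) (hlam : ∀ i, lam i ∈ Set.Icc (0 : ℝ) 2)
    (X : Matrix (Fin n) (Fin d) ℝ)
    (V₀ W₁ W₂ : Matrix (Fin n) (Fin d) ℝ)
    (hV₀ : V₀ = Uᵀ * Matrix.diagonal (fun i => Real.cos (lam i / 8) * Real.cos (lam i / 16)) * U * X)
    (hW₁ : W₁ = Uᵀ * Matrix.diagonal (fun i => Real.sin (lam i / 8) * Real.cos (lam i / 16)) * U * X)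
    (hW₂ : W₂ = Uᵀ * Matrix.diagonal (fun i => Real.sin (lam i / 16)) * U * X) :
    (∑ i, ∑ j, (W₁ i j) ^ 2) + (∑ i, ∑ j, (W₂ i j) ^ 2) ≤ ∑ i, ∑ j, (V₀ i j) ^ 2 := by
  subst hV₀ hW₁ hW₂
  simp only [sum_sq_spectral_filter hU, ← Finset.sum_add_distrib, ← add_mul]
  exact Finset.sum_le_sum fun i _ => Finset.sum_le_sum fun j _ =>
    mul_le_mul_of_nonneg_right (haar_high_pass_sq_le_low_pass_sq (hlam i)) (sq_nonneg _)
end
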